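/- arXiv:math/9610203 — 2 statements merged into one kernel-verified Lean document; each statement's English description precedes it below -/
import Mathlib

section
/- Let m ≥ 3 and let k be an integer with 2 ≤ k ≤ m−1. Let q ≥ 1 and let ℓ₁, …, ℓ_q be integers each ≥ 2 with N := ∑_{ν=1}^q ℓ_ν ≥ 4m − 7. Then there is a dense open subset U of the space ((ℂ^m)*)^N of N-tuples of linear functionals on ℂ^m (with its natural topology) such that for every tuple (H^{(1)}_1, …, H^{(1)}_{ℓ₁}, …, H^{(q)}_1, …, H^{(q)}_{ℓ_q}) ∈ U there is NO k-dimensional ℂ-linear subspace W ⊆ ℂ^m with the property that for every ν ∈ {1, …, q} the restrictions H^{(ν)}_1|_W, …, H^{(ν)}_{ℓ_ν}|_W span a subspace of dimension at most 1 in the dual space of W. (Equivalently: the subvariety 𝒢_{H^{(1)}_1,…,H^{(1)}_{ℓ₁}} ∩ ⋯ ∩ 𝒢_{H^{(q)}_1,…,H^{(q)}_{ℓ_q}} of the Grassmannian of k-planes in ℂ^m is empty for generic hyperplanes.) -/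
open Module

/-- the compact chart of normalized pairs -/
def pairK (m : ℕ) (i j : Fin m) : Set ((Fin m → ℂ) × (Fin m → ℂ)) :=
  {p | (p.1 i = 1 ∧ p.1 j = 0 ∧ p.2 i = 0 ∧ p.2 j = 1) ∧ (∀ s, ‖p.1 s‖ ≤ 1) ∧ ∀ s, ‖p.2 s‖ ≤ 1}

abbrev HFunSpace (m q : ℕ) (ℓ : Fin q → ℕ) := (ν : Fin q) → Fin (ℓ ν) → ((Fin m → ℂ) →L[ℂ] ℂ)

def Minors {m q : ℕ} {ℓ : Fin q → ℕ} (p : (Fin m → ℂ) × (Fin m → ℂ)) (H : HFunSpace m q ℓ) : Prop :=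
  ∀ ν a b, H ν a p.1 * H ν b p.2 = H ν b p.1 * H ν a p.2

def badB (m q : ℕ) (ℓ : Fin q → ℕ) (i j : Fin m) : Set (HFunSpace m q ℓ) :=
  {H | ∃ p ∈ pairK m i j, Minors p H}

lemma pairK_compact (m : ℕ) (i j : Fin m) : IsCompact (pairK m i j) := by
  refine Metric.isCompact_of_isClosed_isBounded ?_ ?_
  · unfold pairK
    simp only [Set.ofPred_and, Set.ofPred_forall]
    refine IsClosed.inter (IsClosed.inter ?_ (IsClosed.inter ?_ (IsClosed.inter ?_ ?_)))
      (IsClosed.inter (isClosed_iInter fun s => ?_) (isClosed_iInter fun s => ?_))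
    · exact isClosed_eq (by fun_prop) (by fun_prop)
    · exact isClosed_eq (by fun_prop) (by fun_prop)
    · exact isClosed_eq (by fun_prop) (by fun_prop)
    · exact isClosed_eq (by fun_prop) (by fun_prop)
    · exact isClosed_le (by fun_prop) (by fun_prop)
    · exact isClosed_le (by fun_prop) (by fun_prop)
  · refine (Metric.isBounded_closedBall (x := (0 : (Fin m → ℂ) × (Fin m → ℂ))) (r := 1)).subset ?_
    rintro ⟨u, v⟩ ⟨-, h1, h2⟩
    rw [mem_closedBall_zero_iff, Prod.norm_def]
    exact max_le ((pi_norm_le_iff_of_nonneg zero_le_one).2 h1)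
      ((pi_norm_le_iff_of_nonneg zero_le_one).2 h2)

lemma badB_closed (m q : ℕ) (ℓ : Fin q → ℕ) (i j : Fin m) : IsClosed (badB m q ℓ i j) := by
  have : CompactSpace (pairK m i j) := isCompact_iff_compactSpace.1 (pairK_compact m i j)
  have hc : IsClosed {x : pairK m i j × HFunSpace m q ℓ | Minors x.1.1 x.2} := by
    unfold Minors
    simp only [Set.ofPred_forall]
    refine isClosed_iInter fun ν => isClosed_iInter fun a => isClosed_iInter fun b => ?_
    have h1 : ∀ c, Continuous fun x : pairK m i j × HFunSpace m q ℓ => x.2 ν c := fun c => by fun_prop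
    have k1 : Continuous fun x : pairK m i j × HFunSpace m q ℓ => x.1.1.1 := by fun_prop
    have k2 : Continuous fun x : pairK m i j × HFunSpace m q ℓ => x.1.1.2 := by fun_prop
    exact isClosed_eq (((h1 a).clm_apply k1).mul ((h1 b).clm_apply k2))
      (((h1 b).clm_apply k1).mul ((h1 a).clm_apply k2))
  have := isClosedMap_snd_of_compactSpace _ hc
  convert this using 1
  ext H
  constructor
  · rintro ⟨p, hp, h⟩
    exact ⟨(⟨p, hp⟩, H), h, rfl⟩
  · rintro ⟨⟨p, H'⟩, h, rfl⟩
    exact ⟨p.1, p.2, h⟩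

abbrev RIdx (m : ℕ) (i j : Fin m) := {p : Fin m // p ≠ i ∧ p ≠ j}

abbrev Par (m q : ℕ) (ℓ : Fin q → ℕ) (i j : Fin m) :=
  ((RIdx m i j → ℂ) × (RIdx m i j → ℂ)) ×
    (((ν : Fin q) → Fin (ℓ ν) → RIdx m i j → ℂ) × ((ν : Fin q) → Fin (ℓ ν) → ℂ) × (Fin q → ℂ))

noncomputable def parMap (m q : ℕ) (ℓ : Fin q → ℕ) (i j : Fin m) (σ : Fin q → Bool)
    (P : Par m q ℓ i j) : HFunSpace m q ℓ := fun ν c =>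
  (∑ r : RIdx m i j, P.2.1 ν c r • ContinuousLinearMap.proj (R := ℂ) (φ := fun _ : Fin m => ℂ) r.1)
  + ((if σ ν then P.2.2.1 ν c else P.2.2.2 ν * P.2.2.1 ν c) - ∑ r, P.1.1 r * P.2.1 ν c r) •
      ContinuousLinearMap.proj (R := ℂ) (φ := fun _ : Fin m => ℂ) i
  + ((if σ ν then P.2.2.2 ν * P.2.2.1 ν c else P.2.2.1 ν c) - ∑ r, P.1.2 r * P.2.1 ν c r) •
      ContinuousLinearMap.proj (R := ℂ) (φ := fun _ : Fin m => ℂ) j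

lemma parMap_contDiff (m q : ℕ) (ℓ : Fin q → ℕ) (i j : Fin m) (σ : Fin q → Bool) :
    ContDiff ℝ 1 (parMap m q ℓ i j σ) := by
  unfold parMap
  refine contDiff_pi.2 fun ν => contDiff_pi.2 fun c => ?_
  have hs : ∀ (f : Par m q ℓ i j → ℂ) (L : (Fin m → ℂ) →L[ℂ] ℂ), ContDiff ℝ 1 f →
      ContDiff ℝ 1 fun P => f P • L := fun f L hf => hf.smul contDiff_const
  have c1 : ∀ r, ContDiff ℝ 1 fun P : Par m q ℓ i j => P.2.1 ν c r := fun r =>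
    contDiff_pi.1 (contDiff_pi.1 (contDiff_pi.1 (contDiff_fst.comp contDiff_snd) ν) c) r
  have c2 : ContDiff ℝ 1 fun P : Par m q ℓ i j => P.2.2.1 ν c :=
    contDiff_pi.1 (contDiff_pi.1 (contDiff_fst.comp (contDiff_snd.comp contDiff_snd)) ν) c
  have c3 : ContDiff ℝ 1 fun P : Par m q ℓ i j => P.2.2.2 ν :=
    contDiff_pi.1 (contDiff_snd.comp (contDiff_snd.comp contDiff_snd)) ν
  have c4 : ∀ r, ContDiff ℝ 1 fun P : Par m q ℓ i j => P.1.1 r := fun r =>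
    contDiff_pi.1 (contDiff_fst.comp contDiff_fst) r
  have c5 : ∀ r, ContDiff ℝ 1 fun P : Par m q ℓ i j => P.1.2 r := fun r =>
    contDiff_pi.1 (contDiff_snd.comp contDiff_fst) r
  refine ContDiff.add (ContDiff.add (ContDiff.sum fun r _ => hs _ _ ?_) (hs _ _ ?_)) (hs _ _ ?_)
  · exact c1 r
  · refine ContDiff.sub ?_ (ContDiff.sum fun r _ => (c4 r).mul (c1 r))
    cases σ ν <;> simp only [if_true, if_false, Bool.false_eq_true]
    · exact c3.mul c2
    · exact c2
  · refine ContDiff.sub ?_ (ContDiff.sum fun r _ => (c5 r).mul (c1 r))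
    cases σ ν <;> simp only [if_true, if_false, Bool.false_eq_true]
    · exact c2
    · exact c3.mul c2

lemma sum_split {m : ℕ} {i j : Fin m} (hij : i ≠ j) (f : Fin m → ℂ) :
    ∑ s, f s = (∑ r : RIdx m i j, f r.1) + f i + f j := by
  classical
  have h : _ = ∑ r : RIdx m i j, f r.1 := Finset.sum_subtype (p := fun p : Fin m => p ≠ i ∧ p ≠ j)
    ((Finset.univ.erase i).erase j) (by intro x; simp; tauto) f
  rw [← h, ← Finset.add_sum_erase Finset.univ f (Finset.mem_univ i),
    ← Finset.add_sum_erase (Finset.univ.erase i) f (a := j) (by simp [hij.symm])]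
  ring

lemma apply_split {m : ℕ} {i j : Fin m} (hij : i ≠ j) (L : (Fin m → ℂ) →L[ℂ] ℂ) (z : Fin m → ℂ) :
    L z = (∑ r : RIdx m i j, L (Pi.single r.1 1) * z r.1) + L (Pi.single i 1) * z i
      + L (Pi.single j 1) * z j := by
  rw [← sum_split hij (fun s => L (Pi.single s 1) * z s)]
  conv_lhs => rw [← Finset.univ_sum_single z]
  rw [map_sum]
  refine Finset.sum_congr rfl fun s _ => ?_
  have : (Pi.single s (z s) : Fin m → ℂ) = z s • Pi.single s 1 := by
    rw [← Pi.single_smul]; simp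
  rw [this, map_smul, smul_eq_mul, mul_comm]

lemma badB_subset (m q : ℕ) (ℓ : Fin q → ℕ) (i j : Fin m) (hij : i ≠ j) :
    badB m q ℓ i j ⊆ ⋃ σ : Fin q → Bool, Set.range (parMap m q ℓ i j σ) := by
  classical
  rintro H ⟨⟨u, v⟩, ⟨⟨hui, huj, hvi, hvj⟩, -, -⟩, hM⟩
  simp only at hui huj hvi hvj
  have key : ∀ ν, ∃ s : Bool, ∃ t : ℂ, ∃ x : Fin (ℓ ν) → ℂ, ∀ c,
      H ν c u = (if s then x c else t * x c) ∧ H ν c v = (if s then t * x c else x c) := by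
    intro ν
    by_cases h : ∃ b, H ν b u ≠ 0
    · obtain ⟨b, hb⟩ := h
      refine ⟨true, H ν b v / H ν b u, fun c => H ν c u, fun c => ⟨by simp, ?_⟩⟩
      have := hM ν c b
      simp only at this
      simp only [if_true]
      field_simp
      linear_combination -this
    · push Not at h
      exact ⟨false, 0, fun c => H ν c v, fun c => ⟨by simp [h], by simp⟩⟩
  choose σ t x hx using key
  refine Set.mem_iUnion.2 ⟨σ, ⟨((fun r => u r.1, fun r => v r.1),
    (fun ν c r => H ν c (Pi.single r.1 1), x, t)), ?_⟩⟩
  funext ν c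
  ext1 z
  have e1 := apply_split hij (H ν c) u
  have e2 := apply_split hij (H ν c) v
  rw [hui, huj, (hx ν c).1] at e1
  rw [hvi, hvj, (hx ν c).2] at e2
  rw [apply_split hij (H ν c) z]
  simp only [parMap, e1, e2]
  simp [mul_comm]

lemma finrank_par (m q : ℕ) (ℓ : Fin q → ℕ) (i j : Fin m) (hij : i ≠ j) :
    finrank ℝ (Par m q ℓ i j) = 2 * (2 * (m - 2) + ((∑ ν, ℓ ν) * (m - 2) + (∑ ν, ℓ ν) + q)) := by
  classical
  have hc : Fintype.card (RIdx m i j) = m - 2 := by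
    rw [Fintype.card_of_subtype ((Finset.univ.erase i).erase j) (by intro x; simp; tauto)]
    rw [Finset.card_erase_of_mem (by simp [hij.symm]), Finset.card_erase_of_mem (by simp)]
    simp; omega
  rw [finrank_real_of_complex]
  simp only [Module.finrank_prod, Module.finrank_pi_fintype, Module.finrank_self, Finset.sum_const,
    Finset.card_univ, hc, Fintype.card_fin, smul_eq_mul, mul_one, ← Finset.sum_mul]
  ring

lemma finrank_H (m q : ℕ) (ℓ : Fin q → ℕ) :
    finrank ℝ (HFunSpace m q ℓ) = 2 * ((∑ ν, ℓ ν) * m) := by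
  have : finrank ℂ ((Fin m → ℂ) →L[ℂ] ℂ) = m := by
    rw [← (LinearMap.toContinuousLinearMap (𝕜 := ℂ) (E := Fin m → ℂ) (F' := ℂ)).finrank_eq,
      Module.finrank_linearMap]
    simp
  have h2 : finrank ℝ ((Fin m → ℂ) →L[ℂ] ℂ) = 2 * m := by
    rw [← Module.finrank_mul_finrank ℝ ℂ ((Fin m → ℂ) →L[ℂ] ℂ), this, Complex.finrank_real_complex]
  simp only [Module.finrank_pi_fintype, h2, Finset.sum_const,
    Finset.card_univ, Fintype.card_fin, smul_eq_mul, ← Finset.sum_mul]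
  ring

lemma exists_norm {m q : ℕ} {ℓ : Fin q → ℕ} (H : HFunSpace m q ℓ) (u v : Fin m → ℂ)
    (huv : LinearIndependent ℂ ![u, v]) (hM : Minors (u, v) H) :
    ∃ i j, i ≠ j ∧ H ∈ badB m q ℓ i j := by
  have hne : ∃ i j, u i * v j - u j * v i ≠ 0 := by
    by_contra! h
    rw [LinearIndependent.pair_iff] at huv
    have hu : u = 0 := by
      funext i
      have := huv (v i) (-u i) (by
        funext s
        have := h i s
        simp only [Pi.add_apply, Pi.smul_apply, smul_eq_mul, Pi.zero_apply]
        linear_combination -this)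
      simpa using this.2
    have := huv 1 0 (by simp [hu])
    simp at this
  obtain ⟨i0, j0, h0⟩ := hne
  obtain ⟨⟨i, j⟩, -, hmax⟩ := Finset.exists_max_image (Finset.univ : Finset (Fin m × Fin m))
    (fun p => ‖u p.1 * v p.2 - u p.2 * v p.1‖) ⟨(i0, j0), Finset.mem_univ _⟩
  have hmax' : ∀ a b, ‖u a * v b - u b * v a‖ ≤ ‖u i * v j - u j * v i‖ :=
    fun a b => hmax (a, b) (Finset.mem_univ _)
  set D := u i * v j - u j * v i with hD
  have hD0 : D ≠ 0 := by
    have := hmax' i0 j0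
    have h1 := norm_pos_iff.2 h0
    exact norm_pos_iff.1 (h1.trans_le this)
  have hij : i ≠ j := by
    rintro rfl
    exact hD0 (by rw [hD]; ring)
  refine ⟨i, j, hij, ((v j / D) • u - (u j / D) • v, (u i / D) • v - (v i / D) • u),
    ⟨⟨?_, ?_, ?_, ?_⟩, ?_, ?_⟩, ?_⟩
  · simp; field_simp; rw [hD]; ring
  · simp; field_simp; ring
  · simp; field_simp; ring
  · simp; field_simp; rw [hD]; ring
  · intro s
    have : ((v j / D) • u - (u j / D) • v) s = (u s * v j - u j * v s) / D := by
      simp; field_simp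
    dsimp only
    rw [this, norm_div, div_le_one (norm_pos_iff.2 hD0)]
    exact hmax' s j
  · intro s
    have : ((u i / D) • v - (v i / D) • u) s = (u i * v s - u s * v i) / D := by
      simp; field_simp
    dsimp only
    rw [this, norm_div, div_le_one (norm_pos_iff.2 hD0)]
    exact hmax' i s
  · intro ν a b
    have := hM ν a b
    simp only [map_sub, map_smul, smul_eq_mul] at this ⊢
    linear_combination (v j / D * (u i / D) - u j / D * (v i / D)) * this


/-- **Proposition 4 of Siu–Yeung.** For `2 ≤ k ≤ m−1`, `q ≥ 1`, `ℓ_ν ≥ 2`, and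
`N = ∑ ℓ_ν ≥ 4m − 7`, for a dense open set of tuples of linear functionals
`H^{(ν)}_i` on `ℂ^m` there is no `k`-dimensional subspace `W ⊆ ℂ^m` such that, for
every `ν`, the restrictions `H^{(ν)}_1|_W, …, H^{(ν)}_{ℓ_ν}|_W` span a subspace of
dimension at most `1` of the dual of `W`. -/
theorem grassmannian_intersection_empty
    (m k q : ℕ) (hm : 3 ≤ m) (hk : 2 ≤ k) (hkm : k ≤ m - 1) (hq : 1 ≤ q)
    (ℓ : Fin q → ℕ) (hℓ : ∀ ν, 2 ≤ ℓ ν)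
    (hN : 4 * m - 7 ≤ ∑ ν, ℓ ν) :
    ∃ U : Set ((ν : Fin q) → Fin (ℓ ν) → ((Fin m → ℂ) →L[ℂ] ℂ)),
      IsOpen U ∧ Dense U ∧
      ∀ H ∈ U,
        ¬ ∃ W : Submodule ℂ (Fin m → ℂ), Module.finrank ℂ W = k ∧
          ∀ ν : Fin q,
            Module.finrank ℂ
              (Submodule.span ℂ
                (Set.range fun i : Fin (ℓ ν) =>
                  ((H ν i).toLinearMap.comp W.subtype))) ≤ 1 := by
  classical
  refine ⟨(⋃ p : {p : Fin m × Fin m // p.1 ≠ p.2}, badB m q ℓ p.1.1 p.1.2)ᶜ, ?_, ?_, ?_⟩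
  · exact (isClosed_iUnion_of_finite fun p => badB_closed m q ℓ _ _).isOpen_compl
  · apply dense_compl_of_dimH_lt_finrank
    have hq2 : 2 * q ≤ ∑ ν, ℓ ν := by
      have := Finset.sum_le_sum fun (ν : Fin q) (_ : ν ∈ Finset.univ) => hℓ ν
      simpa [mul_comm] using this
    have hle : dimH (⋃ p : {p : Fin m × Fin m // p.1 ≠ p.2}, badB m q ℓ p.1.1 p.1.2) ≤
        ((2 * (2 * (m - 2) + ((∑ ν, ℓ ν) * (m - 2) + (∑ ν, ℓ ν) + q)) : ℕ) : ENNReal) := by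
      rw [dimH_iUnion]
      refine iSup_le fun p => (dimH_mono (badB_subset m q ℓ _ _ p.2)).trans ?_
      rw [dimH_iUnion]
      refine iSup_le fun σ => ?_
      rw [← finrank_par m q ℓ _ _ p.2]
      exact (parMap_contDiff m q ℓ _ _ σ).dimH_range_le
    refine hle.trans_lt ?_
    rw [finrank_H]
    refine Nat.cast_lt.2 ?_
    obtain ⟨n, rfl⟩ : ∃ n, m = n + 3 := ⟨m - 3, by omega⟩
    have e : n + 3 - 2 = n + 1 := by omega
    rw [e]
    generalize ∑ ν, ℓ ν = N at *
    have : N * (n + 3) = N * (n + 1) + N + N := by ring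
    omega
  · rintro H hH ⟨W, hW, hspan⟩
    apply hH
    obtain ⟨f, hf⟩ := exists_linearIndependent_of_le_finrank (R := ℂ) (M := W) (n := 2) (by omega)
    have hf' := hf.map' W.subtype (Submodule.ker_subtype W)
    have hM : Minors ((f 0 : Fin m → ℂ), (f 1 : Fin m → ℂ)) H := by
      intro ν a b
      obtain ⟨g, hg⟩ := finrank_le_one_iff.1 (hspan ν)
      have hh : ∀ a, ∃ r : ℂ, ∀ w : W, H ν a w = r * (g : W →ₗ[ℂ] ℂ) w := by
        intro a
        obtain ⟨r, hr⟩ := hg ⟨_, Submodule.subset_span ⟨a, rfl⟩⟩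
        refine ⟨r, fun w => ?_⟩
        have := congrArg (fun z => z w) (congrArg Subtype.val hr)
        simpa using this.symm
      obtain ⟨r, hr⟩ := hh a
      obtain ⟨r', hr'⟩ := hh b
      simp only [hr, hr']
      ring
    have hli : LinearIndependent ℂ ![(f 0 : Fin m → ℂ), (f 1 : Fin m → ℂ)] := by
      have e : ![(f 0 : Fin m → ℂ), (f 1 : Fin m → ℂ)] = W.subtype ∘ f := by
        funext s
        fin_cases s <;> rfl
      rw [e]
      exact hf'
    obtain ⟨i, j, hij, hb⟩ := exists_norm H _ _ hli hM
    exact Set.mem_iUnion.2 ⟨⟨(i, j), hij⟩, hb⟩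
end

section
/- Let n ≥ 11 be an integer and let c₁, c₂ be nonzero complex numbers. Suppose u, v, w : ℂ → ℂ are entire functions with no common zero satisfying u(z)ⁿ = c₁ v(z)ⁿ + c₂ w(z)ⁿ for all z ∈ ℂ. Then the induced holomorphic map [u : v : w] : ℂ → ℙ₂(ℂ) is constant, i.e. for all z, z' ∈ ℂ the vectors (u(z), v(z), w(z)) and (u(z'), v(z'), w(z')) in ℂ³ are ℂ-linearly dependent. -/
open Filter Topology Complex

lemma fc_lagrange (a b c a' b' c' : ℂ) :
    (normSq a + normSq b + normSq c) * (normSq a' + normSq b' + normSq c') =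
      normSq (a * (starRingEnd ℂ) a' + b * (starRingEnd ℂ) b' + c * (starRingEnd ℂ) c') +
      (normSq (a * b' - b * a') + normSq (a * c' - c * a') + normSq (b * c' - c * b')) := by
  simp [Complex.normSq_apply]; ring

lemma fc_disc (R : ℝ) (z a : ℂ) :
    (R ^ 2 - normSq z) * (R ^ 2 - normSq a) =
      normSq ((R : ℂ) ^ 2 - (starRingEnd ℂ) a * z) - R ^ 2 * normSq (z - a) := by
  simp [Complex.normSq_apply, pow_two]; ring

lemma fc_ineq (m : ℕ) (hm : 1 ≤ m) (Sg Sw P D : ℝ) (hg : 0 < Sg) (hP : 0 < P) (hD : 0 < D)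
    (hDP : 6 * D < P) (hw : 3 * D * Sg < Sw * P) :
    Sg ^ m * P ^ 2 < (Sg + Sw) ^ m * (P - D) ^ 2 := by
  have hSw : 0 < Sw := by
    by_contra hcon
    have h1 : Sw * P ≤ 0 := mul_nonpos_of_nonpos_of_nonneg (not_lt.mp hcon) hP.le
    have : 0 < 3 * D * Sg := by positivity
    linarith
  obtain ⟨k, rfl⟩ : ∃ k, m = k + 1 := ⟨m - 1, by omega⟩
  have h1 : Sg ^ k ≤ (Sg + Sw) ^ k := by gcongr; linarith
  have h2 : Sg * P ^ 2 < (Sg + Sw) * (P - D) ^ 2 := by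
    have e1 : (Sg + Sw) * P > Sg * (P + 3 * D) := by nlinarith
    have e2 : P ^ 3 < (P + 3 * D) * (P - D) ^ 2 := by
      have : (P + 3 * D) * (P - D) ^ 2 - P ^ 3 = D * (P * (P - 5 * D)) + 3 * D ^ 3 := by ring
      have : 0 < D * (P * (P - 5 * D)) := mul_pos hD (mul_pos hP (by linarith))
      have : 0 < D ^ 3 := by positivity
      linarith
    have e3 : 0 < (P - D) ^ 2 := pow_pos (by linarith) 2
    have e4 := mul_lt_mul_of_pos_right e1 e3
    have e5 := mul_lt_mul_of_pos_left e2 hg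
    refine lt_of_mul_lt_mul_right ?_ hP.le
    nlinarith
  calc Sg ^ (k + 1) * P ^ 2 = Sg ^ k * (Sg * P ^ 2) := by ring
    _ < Sg ^ k * ((Sg + Sw) * (P - D) ^ 2) := by
        exact mul_lt_mul_of_pos_left h2 (by positivity)
    _ ≤ (Sg + Sw) ^ k * ((Sg + Sw) * (P - D) ^ 2) := by gcongr
    _ = _ := by ring

lemma fc_slope (f : ℂ → ℂ) (f' a : ℂ) (hf : HasDerivAt f f' a) (h0 : f a = 0) :
    Tendsto (fun z => normSq (f z) / normSq (z - a)) (𝓝[≠] a) (𝓝 (normSq f')) := by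
  have h1 := (hasDerivAt_iff_tendsto_slope.mp hf)
  have h2 := (Complex.continuous_normSq.tendsto f').comp h1
  refine h2.congr ?_
  intro z
  simp [slope, h0, div_eq_inv_mul]

/-- At an interior maximum the curvature comparison holds. -/
lemma fc_max (m : ℕ) (hm : 1 ≤ m) (h u v w : ℂ → ℂ) (hh : Differentiable ℂ h)
    (hu : Differentiable ℂ u) (hv : Differentiable ℂ v) (hw : Differentiable ℂ w)
    (R : ℝ) (a : ℂ) (ha : normSq a < R ^ 2) (hR : 0 < R)
    (hS : 0 < normSq (u a) + normSq (v a) + normSq (w a)) (hha : h a ≠ 0)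
    (hmax : ∀ᶠ z in 𝓝 a,
      normSq (h z) * (normSq (u z) + normSq (v z) + normSq (w z)) ^ m * (R ^ 2 - normSq z) ^ 2 ≤
      normSq (h a) * (normSq (u a) + normSq (v a) + normSq (w a)) ^ m * (R ^ 2 - normSq a) ^ 2) :
    (normSq (u a * deriv v a - v a * deriv u a) + normSq (u a * deriv w a - w a * deriv u a)
      + normSq (v a * deriv w a - w a * deriv v a)) * (R ^ 2 - normSq a) ^ 2 ≤
      3 * R ^ 2 * (normSq (u a) + normSq (v a) + normSq (w a)) ^ 2 := by
  by_contra hcon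
  push Not at hcon
  set S : ℂ → ℝ := fun z => normSq (u z) + normSq (v z) + normSq (w z) with hSdef
  set T : ℝ := normSq (u a * deriv v a - v a * deriv u a) +
    normSq (u a * deriv w a - w a * deriv u a)
      + normSq (v a * deriv w a - w a * deriv v a) with hT
  have hSa : normSq (u a) + normSq (v a) + normSq (w a) = S a := rfl
  rw [hSa] at hS hcon
  set g : ℂ → ℂ := fun z => u z * (starRingEnd ℂ) (u a) + v z * (starRingEnd ℂ) (v a) +
    w z * (starRingEnd ℂ) (w a) with hg
  set p : ℂ → ℂ := fun z => (R : ℂ) ^ 2 - (starRingEnd ℂ) a * z with hp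
  set W : ℂ → ℝ := fun z => normSq (u z * v a - v z * u a) + normSq (u z * w a - w z * u a) +
    normSq (v z * w a - w z * v a) with hW
  have hgd : Differentiable ℂ g := by
    exact ((hu.mul_const _).add (hv.mul_const _)).add (hw.mul_const _)
  have hpd : Differentiable ℂ p := by
    intro z; simp only [hp]; fun_prop
  have hga : g a = (S a : ℂ) := by
    simp only [hg, hSdef, Complex.mul_conj]; push_cast; ring
  have hpa : p a = ((R ^ 2 - normSq a : ℝ) : ℂ) := by
    simp only [hp]; rw [mul_comm, Complex.mul_conj]; push_cast; ring
  have hlag : ∀ z, S z * S a = normSq (g z) + W z := fun z => fc_lagrange _ _ _ _ _ _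
  have hdisc : ∀ z, (R ^ 2 - normSq z) * (R ^ 2 - normSq a) =
      normSq (p z) - R ^ 2 * normSq (z - a) := fun z => fc_disc R z a
  set r : ℝ := R ^ 2 - normSq a with hr
  have hr0 : 0 < r := by linarith
  have hNg : normSq (g a) = S a ^ 2 := by rw [hga, Complex.normSq_ofReal]; ring
  have hNp : normSq (p a) = r ^ 2 := by rw [hpa, Complex.normSq_ofReal]; ring
  -- limits
  have hWlim : Tendsto (fun z => W z / normSq (z - a)) (𝓝[≠] a) (𝓝 T) := by
    have du := (hu a).hasDerivAt
    have dv := (hv a).hasDerivAt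
    have dw := (hw a).hasDerivAt
    have l1 := fc_slope (fun z => u z * v a - v z * u a) _ a
      ((du.mul_const (v a)).sub (dv.mul_const (u a))) (by ring)
    have l2 := fc_slope (fun z => u z * w a - w z * u a) _ a
      ((du.mul_const (w a)).sub (dw.mul_const (u a))) (by ring)
    have l3 := fc_slope (fun z => v z * w a - w z * v a) _ a
      ((dv.mul_const (w a)).sub (dw.mul_const (v a))) (by ring)
    have l := (l1.add l2).add l3
    have e : T = normSq (deriv u a * v a - deriv v a * u a) +
        normSq (deriv u a * w a - deriv w a * u a) +
        normSq (deriv v a * w a - deriv w a * v a) := by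
      rw [hT]
      rw [← Complex.normSq_neg (u a * deriv v a - v a * deriv u a),
        ← Complex.normSq_neg (u a * deriv w a - w a * deriv u a),
        ← Complex.normSq_neg (v a * deriv w a - w a * deriv v a)]
      congr 2 <;> [congr 1; congr 1; skip] <;> ring_nf
    rw [e]
    refine l.congr ?_
    intro z
    simp only [hW]; ring
  have hgl : Tendsto (fun z => normSq (g z)) (𝓝[≠] a) (𝓝 (S a ^ 2)) := by
    rw [← hNg]
    exact ((Complex.continuous_normSq.comp hgd.continuous).tendsto a).mono_left nhdsWithin_le_nhds
  have hpl : Tendsto (fun z => normSq (p z)) (𝓝[≠] a) (𝓝 (r ^ 2)) := by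
    rw [← hNp]
    exact ((Complex.continuous_normSq.comp hpd.continuous).tendsto a).mono_left nhdsWithin_le_nhds
  have hDl : Tendsto (fun z => 6 * (R ^ 2 * normSq (z - a))) (𝓝[≠] a) (𝓝 0) := by
    have : Continuous (fun z => 6 * (R ^ 2 * normSq (z - a))) := by
      have := Complex.continuous_normSq
      fun_prop
    have h2 := (this.tendsto a).mono_left (nhdsWithin_le_nhds (s := {a}ᶜ))
    simpa using h2
  have ev1 : ∀ᶠ z in 𝓝[≠] a, 3 * R ^ 2 * normSq (g z) < W z / normSq (z - a) * normSq (p z) := by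
    exact (hgl.const_mul (3 * R ^ 2)).eventually_lt (hWlim.mul hpl) hcon
  have ev2 : ∀ᶠ z in 𝓝[≠] a, 6 * (R ^ 2 * normSq (z - a)) < normSq (p z) :=
    hDl.eventually_lt hpl (by positivity)
  have ev3 : ∀ᶠ z in 𝓝[≠] a, 0 < normSq (g z) := hgl.eventually_const_lt (by positivity)
  have evh : ∀ᶠ z in 𝓝[≠] a, h z ≠ 0 :=
    (hh.continuous.continuousAt.eventually_ne hha).filter_mono nhdsWithin_le_nhds
  set G : ℂ → ℂ := fun z => h z * g z ^ m * p z ^ 2 with hG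
  have hGd : Differentiable ℂ G := (hh.mul (hgd.pow m)).mul (hpd.pow 2)
  have key : ∀ᶠ z in 𝓝[≠] a, normSq (G z) < normSq (G a) := by
    filter_upwards [ev1, ev2, ev3, evh, hmax.filter_mono nhdsWithin_le_nhds,
      self_mem_nhdsWithin] with z e1 e2 e3 e4 e5 e6
    have hz : 0 < normSq (z - a) := Complex.normSq_pos.mpr (sub_ne_zero.mpr e6)
    have hD : 0 < R ^ 2 * normSq (z - a) := by positivity
    have hi := fc_ineq m hm (normSq (g z)) (W z) (normSq (p z)) (R ^ 2 * normSq (z - a)) e3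
      (by linarith) hD e2 (by
        have := mul_lt_mul_of_pos_right e1 hz
        have e : W z / normSq (z - a) * normSq (p z) * normSq (z - a) = W z * normSq (p z) := by
          field_simp
        rw [e] at this
        linarith)
    rw [← hlag, ← hdisc] at hi
    have hi2 := mul_lt_mul_of_pos_left hi (Complex.normSq_pos.mpr e4)
    have hcpos : 0 ≤ S a ^ m * r ^ 2 := by positivity
    have e5' := mul_le_mul_of_nonneg_right e5 hcpos
    simp only [hG, map_mul, map_pow, hNg, hNp]
    calc normSq (h z) * normSq (g z) ^ m * normSq (p z) ^ 2
        = normSq (h z) * (normSq (g z) ^ m * normSq (p z) ^ 2) := by ring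
      _ < _ := hi2
      _ = normSq (h z) * S z ^ m * (R ^ 2 - normSq z) ^ 2 * (S a ^ m * r ^ 2) := by
        rw [mul_pow, mul_pow]; ring
      _ ≤ normSq (h a) * S a ^ m * r ^ 2 * (S a ^ m * r ^ 2) := e5'
      _ = _ := by ring
  have key' : ∀ᶠ z in 𝓝[≠] a, ‖G z‖ < ‖G a‖ := by
    filter_upwards [key] with z hz
    rw [Complex.normSq_eq_norm_sq, Complex.normSq_eq_norm_sq] at hz
    exact lt_of_pow_lt_pow_left₀ 2 (norm_nonneg _) hz
  have hloc : IsLocalMax (norm ∘ G) a := by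
    rw [eventually_nhdsWithin_iff] at key'
    filter_upwards [key'] with z hz
    by_cases hza : z = a
    · simp [hza]
    · exact (hz hza).le
  have hconst := Complex.eventually_eq_of_isLocalMax_norm
    (Eventually.of_forall fun z => hGd z) hloc
  have := (key'.and (hconst.filter_mono nhdsWithin_le_nhds)).exists
  obtain ⟨z, h1, h2⟩ := this
  rw [h2] at h1
  exact lt_irrefl _ h1

/-- Ahlfors-Schwarz type vanishing. -/
lemma fc_vanish (m : ℕ) (hm : 1 ≤ m) (h u v w : ℂ → ℂ) (hh : Differentiable ℂ h)
    (hu : Differentiable ℂ u) (hv : Differentiable ℂ v) (hw : Differentiable ℂ w)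
    (hS : ∀ a, 0 < normSq (u a) + normSq (v a) + normSq (w a)) (C : ℝ) (hC : 0 < C)
    (hcurv : ∀ a, C * normSq (h a) * (normSq (u a) + normSq (v a) + normSq (w a)) ^ (m + 2) ≤
      normSq (u a * deriv v a - v a * deriv u a) + normSq (u a * deriv w a - w a * deriv u a)
      + normSq (v a * deriv w a - w a * deriv v a)) (b : ℂ) : h b = 0 := by
  by_contra hb
  set S : ℂ → ℝ := fun z => normSq (u z) + normSq (v z) + normSq (w z) with hSdef
  have hSc : Continuous S := by
    have h1 := Complex.continuous_normSq
    exact ((h1.comp hu.continuous).add (h1.comp hv.continuous)).add (h1.comp hw.continuous)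
  have hhc : Continuous fun z => normSq (h z) := Complex.continuous_normSq.comp hh.continuous
  have bound : ∀ R : ℝ, 0 < R → normSq b < R ^ 2 →
      C * (normSq (h b) * S b ^ m) * (R ^ 2 - normSq b) ^ 2 ≤ 3 * R ^ 2 := by
    intro R hR hbR
    set F : ℂ → ℝ := fun z => normSq (h z) * S z ^ m * (R ^ 2 - normSq z) ^ 2 with hF
    have hFc : Continuous F :=
      (hhc.mul (hSc.pow m)).mul ((continuous_const.sub Complex.continuous_normSq).pow 2)
    have mem : ∀ z : ℂ, z ∈ Metric.closedBall (0 : ℂ) R ↔ normSq z ≤ R ^ 2 := by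
      intro z
      rw [mem_closedBall_zero_iff, Complex.normSq_eq_norm_sq,
        pow_le_pow_iff_left₀ (norm_nonneg _) hR.le two_ne_zero]
    obtain ⟨a, haM, hamax⟩ := (isCompact_closedBall (0 : ℂ) R).exists_isMaxOn
      ⟨b, (mem b).mpr hbR.le⟩ hFc.continuousOn
    have hFb : 0 < F b := by
      have h1 := Complex.normSq_pos.mpr hb
      have h2 := hS b
      have h3 : 0 < R ^ 2 - normSq b := by linarith
      change 0 < normSq (h b) * (normSq (u b) + normSq (v b) + normSq (w b)) ^ m * _ ^ 2
      positivity
    have hba : F b ≤ F a := hamax ((mem b).mpr hbR.le)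
    have hFa : 0 < F a := lt_of_lt_of_le hFb hba
    have hha : h a ≠ 0 := by
      intro h0
      simp [hF, h0] at hFa
    have haR : normSq a < R ^ 2 := by
      refine lt_of_le_of_ne ((mem a).mp haM) ?_
      intro h0
      simp [hF, h0] at hFa
    have hnh : ∀ᶠ z in 𝓝 a, F z ≤ F a := by
      have : ∀ᶠ z in 𝓝 a, normSq z < R ^ 2 :=
        Complex.continuous_normSq.continuousAt.eventually_lt_const haR
      filter_upwards [this] with z hz
      exact hamax ((mem z).mpr hz.le)
    have h1 := fc_max m hm h u v w hh hu hv hw R a haR hR (hS a) hha hnh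
    have h2 := mul_le_mul_of_nonneg_right (hcurv a) (sq_nonneg (R ^ 2 - normSq a))
    have h3 := h2.trans h1
    have hSa : 0 < S a := hS a
    have h4 : C * F a * S a ^ 2 ≤ 3 * R ^ 2 * S a ^ 2 := by
      calc C * F a * S a ^ 2 = C * normSq (h a) * S a ^ (m + 2) * (R ^ 2 - normSq a) ^ 2 := by
            simp only [hF]; ring
        _ ≤ _ := h3
    have h5 : C * F a ≤ 3 * R ^ 2 := le_of_mul_le_mul_right h4 (by positivity)
    calc C * (normSq (h b) * S b ^ m) * (R ^ 2 - normSq b) ^ 2 = C * F b := by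
          simp only [hF]; ring
      _ ≤ C * F a := by gcongr
      _ ≤ _ := h5
  set K := C * (normSq (h b) * S b ^ m) with hK
  have hKpos : 0 < K := by
    have h1 := Complex.normSq_pos.mpr hb
    have h2 : 0 < S b := hS b
    positivity
  set N := normSq b with hN
  have hN0 : 0 ≤ N := Complex.normSq_nonneg b
  -- choose `R ^ 2 = 2 N + 13 / K`
  set Q := 2 * N + 13 / K with hQ
  have hQpos : 0 < Q := by positivity
  have hQN : N < Q := by
    have : 0 < 13 / K := by positivity
    linarith
  have h1 := bound (Real.sqrt Q) (Real.sqrt_pos.mpr hQpos) (by rw [Real.sq_sqrt hQpos.le]; exact hQN)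
  rw [Real.sq_sqrt hQpos.le] at h1
  have h2 : Q / 2 ≤ Q - N := by
    have : 0 < 13 / K := by positivity
    linarith
  have h3 : (Q / 2) ^ 2 ≤ (Q - N) ^ 2 := by gcongr
  have h4 : K * (Q / 2) ^ 2 ≤ 3 * Q := (mul_le_mul_of_nonneg_left h3 hKpos.le).trans h1
  have h5 : 13 ≤ K * Q := by
    rw [hQ, mul_add, mul_div_cancel₀ _ hKpos.ne']
    have : 0 ≤ K * (2 * N) := by positivity
    linarith
  nlinarith

lemma fc_pow_sum (N : ℕ) (x y z : ℝ) (hx : 0 ≤ x) (hy : 0 ≤ y) (hz : 0 ≤ z) :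
    (x + y + z) ^ N ≤ 3 ^ N * (x ^ N + y ^ N + z ^ N) := by
  have px := pow_nonneg hx N
  have py := pow_nonneg hy N
  have pz := pow_nonneg hz N
  have aux : ∀ t : ℝ, 0 ≤ t → x ≤ t → y ≤ t → z ≤ t → t ^ N ≤ x ^ N + y ^ N + z ^ N →
      (x + y + z) ^ N ≤ 3 ^ N * (x ^ N + y ^ N + z ^ N) := by
    intro t ht h1 h2 h3 h4
    calc (x + y + z) ^ N ≤ (3 * t) ^ N := by gcongr; linarith
      _ = 3 ^ N * t ^ N := mul_pow _ _ _
      _ ≤ _ := by gcongr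
  rcases le_total x y with h1 | h1 <;> rcases le_total y z with h2 | h2 <;>
    rcases le_total x z with h3 | h3
  all_goals first
    | exact aux x hx le_rfl (by linarith) (by linarith) (by linarith)
    | exact aux y hy (by linarith) le_rfl (by linarith) (by linarith)
    | exact aux z hz (by linarith) (by linarith) le_rfl (by linarith)

/-- Vanishing Wronskian gives proportionality. -/
lemma fc_prop (f g : ℂ → ℂ) (hf : Differentiable ℂ f) (hg : Differentiable ℂ g)
    (hW : ∀ z, f z * deriv g z - g z * deriv f z = 0) (a : ℂ) (ha : g a ≠ 0) (z : ℂ) :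
    f z * g a = g z * f a := by
  have hne : ∀ᶠ y in 𝓝 a, g y ≠ 0 := hg.continuous.continuousAt.eventually_ne ha
  obtain ⟨ε, hε, hball⟩ := Metric.eventually_nhds_iff_ball.mp hne
  have hd : DifferentiableOn ℂ (fun y => f y / g y) (Metric.ball a ε) := fun y hy =>
    ((hf y).div (hg y) (hball y hy)).differentiableWithinAt
  have hc : ∀ y ∈ Metric.ball a ε, f y / g y = f a / g a := by
    intro y hy
    refine Metric.isOpen_ball.is_const_of_deriv_eq_zero
      (convex_ball a ε).isPreconnected hd ?_ hy (Metric.mem_ball_self hε)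
    intro x hx
    have := ((hf x).hasDerivAt.div (hg x).hasDerivAt (hball x hx)).deriv
    change deriv (f / g) x = 0
    rw [this]
    have h2 := hW x
    have : deriv f x * g x - f x * deriv g x = 0 := by linear_combination -h2
    simp [this]
  have hev : (fun y => f y * g a) =ᶠ[𝓝 a] fun y => g y * f a := by
    filter_upwards [Metric.ball_mem_nhds a hε] with y hy
    have := hc y hy
    rw [div_eq_div_iff (hball y hy) ha] at this
    linear_combination this
  have A1 : AnalyticOnNhd ℂ (fun y => f y * g a) Set.univ :=
    fun y _ => (hf.mul_const _).analyticAt y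
  have A2 : AnalyticOnNhd ℂ (fun y => g y * f a) Set.univ :=
    fun y _ => (hg.mul_const _).analyticAt y
  exact congrFun (A1.eq_of_eventuallyEq A2 hev) z

/-- **Fermat-curve step in the proof of Theorem 4 of Siu–Yeung.** For `n ≥ 11` and
nonzero `c₁, c₂ ∈ ℂ`, any reduced triple of entire functions `u, v, w` (no common
zero) with `uⁿ = c₁vⁿ + c₂wⁿ` induces a constant map `ℂ → ℙ₂(ℂ)`. -/
theorem fermat_curve_map_constant
    (n : ℕ) (hn : 11 ≤ n) (c₁ c₂ : ℂ) (hc₁ : c₁ ≠ 0) (hc₂ : c₂ ≠ 0)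
    (u v w : ℂ → ℂ)
    (hu : Differentiable ℂ u) (hv : Differentiable ℂ v) (hw : Differentiable ℂ w)
    (hnz : ∀ z : ℂ, ¬ (u z = 0 ∧ v z = 0 ∧ w z = 0))
    (heq : ∀ z : ℂ, u z ^ n = c₁ * v z ^ n + c₂ * w z ^ n) :
    ∀ z z' : ℂ,
      ¬ LinearIndependent ℂ ![![u z, v z, w z], ![u z', v z', w z']] := by
  obtain ⟨m, rfl⟩ : ∃ m, n = m + 3 := ⟨n - 3, by omega⟩
  have hm : 1 ≤ m := by omega
  -- derivative relation
  have hder : ∀ z, u z ^ (m + 2) * deriv u z =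
      c₁ * (v z ^ (m + 2) * deriv v z) + c₂ * (w z ^ (m + 2) * deriv w z) := by
    intro z
    have d1 := (hu z).hasDerivAt.pow (m + 3)
    have d2 := (((hv z).hasDerivAt.pow (m + 3)).const_mul c₁).add
      (((hw z).hasDerivAt.pow (m + 3)).const_mul c₂)
    have e : u ^ (m + 3) = (fun y => c₁ * (v ^ (m + 3)) y) + fun y => c₂ * (w ^ (m + 3)) y := by
      funext y; exact heq y
    rw [e] at d1
    have := d1.unique d2
    have hne : ((m + 3 : ℕ) : ℂ) ≠ 0 := by exact_mod_cast (by omega : m + 3 ≠ 0)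
    simp only [show m + 3 - 1 = m + 2 by omega] at this
    refine mul_left_cancel₀ hne ?_
    linear_combination this
  have hnu : ∀ z, u z = 0 → w z ≠ 0 ∧ v z ≠ 0 := by
    intro z h0
    have h1 := heq z
    rw [h0, zero_pow (by omega)] at h1
    constructor
    · intro h2
      rw [h2, zero_pow (by omega), mul_zero, add_zero] at h1
      have h3 := pow_eq_zero_iff (by omega) |>.mp ((mul_eq_zero.mp h1.symm).resolve_left hc₁)
      exact hnz z ⟨h0, h3, h2⟩
    · intro h2
      rw [h2, zero_pow (by omega), mul_zero, zero_add] at h1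
      have h3 := pow_eq_zero_iff (by omega) |>.mp ((mul_eq_zero.mp h1.symm).resolve_left hc₂)
      exact hnz z ⟨h0, h2, h3⟩
  set A : ℂ → ℂ := fun z => v z * deriv w z - w z * deriv v z with hA
  set B : ℂ → ℂ := fun z => u z * deriv v z - v z * deriv u z with hB
  set D : ℂ → ℂ := fun z => u z * deriv w z - w z * deriv u z with hD
  have dud : Differentiable ℂ (deriv u) := hu.deriv
  have dvd : Differentiable ℂ (deriv v) := hv.deriv
  have dwd : Differentiable ℂ (deriv w) := hw.deriv
  have hAd : Differentiable ℂ A := (hv.mul dwd).sub (hw.mul dvd)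
  have hBd : Differentiable ℂ B := (hu.mul dvd).sub (hv.mul dud)
  have r1 : ∀ z, u z ^ (m + 2) * B z = -c₂ * w z ^ (m + 2) * A z := by
    intro z
    simp only [hA, hB]
    linear_combination deriv v z * heq z - v z * hder z
  have r2 : ∀ z, u z ^ (m + 2) * D z = c₁ * v z ^ (m + 2) * A z := by
    intro z
    simp only [hA, hD]
    linear_combination deriv w z * heq z - w z * hder z
  classical
  set h : ℂ → ℂ := fun z => if u z = 0 then B z / (-c₂ * w z ^ (m + 2)) else A z / u z ^ (m + 2)
    with hh
  have hA' : ∀ z, A z = h z * u z ^ (m + 2) := by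
    intro z
    by_cases h0 : u z = 0
    · have h1 := r1 z
      obtain ⟨h2, h3⟩ := hnu z h0
      rw [h0, zero_pow (by omega), zero_mul] at h1
      rw [h0, zero_pow (by omega), mul_zero]
      have : -c₂ * w z ^ (m + 2) ≠ 0 := mul_ne_zero (neg_ne_zero.mpr hc₂) (pow_ne_zero _ h2)
      exact (mul_eq_zero.mp h1.symm).resolve_left this
    · simp only [hh, if_neg h0]
      rw [div_mul_cancel₀ _ (pow_ne_zero _ h0)]
  have hB' : ∀ z, B z = h z * (-c₂ * w z ^ (m + 2)) := by
    intro z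
    by_cases h0 : u z = 0
    · obtain ⟨h2, h3⟩ := hnu z h0
      have : -c₂ * w z ^ (m + 2) ≠ 0 := mul_ne_zero (neg_ne_zero.mpr hc₂) (pow_ne_zero _ h2)
      simp only [hh, if_pos h0]
      rw [div_mul_cancel₀ _ this]
    · refine mul_left_cancel₀ (pow_ne_zero (m + 2) h0) ?_
      rw [r1, hA' z]; ring
  have hD' : ∀ z, D z = h z * (c₁ * v z ^ (m + 2)) := by
    intro z
    by_cases h0 : u z = 0
    · obtain ⟨h2, h3⟩ := hnu z h0
      have e1 : v z * D z = u z * A z + w z * B z := by simp only [hA, hB, hD]; ring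
      refine mul_left_cancel₀ h3 ?_
      rw [e1, hB' z, h0]
      have h1 := heq z
      rw [h0, zero_pow (by omega)] at h1
      linear_combination h z * h1
    · refine mul_left_cancel₀ (pow_ne_zero (m + 2) h0) ?_
      rw [r2, hA' z]; ring
  have hhd : Differentiable ℂ h := by
    intro z
    by_cases h0 : u z = 0
    · obtain ⟨h2, h3⟩ := hnu z h0
      have : -c₂ * w z ^ (m + 2) ≠ 0 := mul_ne_zero (neg_ne_zero.mpr hc₂) (pow_ne_zero _ h2)
      have hd : DifferentiableAt ℂ (fun y => B y / (-c₂ * w y ^ (m + 2))) z :=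
        (hBd z).div (((hw z).pow _).const_mul _) this
      refine hd.congr_of_eventuallyEq ?_
      filter_upwards [hw.continuous.continuousAt.eventually_ne h2] with y hy
      have : -c₂ * w y ^ (m + 2) ≠ 0 := mul_ne_zero (neg_ne_zero.mpr hc₂) (pow_ne_zero _ hy)
      rw [eq_div_iff this, ← hB' y]
    · have hd : DifferentiableAt ℂ (fun y => A y / u y ^ (m + 2)) z :=
        (hAd z).div ((hu z).pow _) (pow_ne_zero _ h0)
      refine hd.congr_of_eventuallyEq ?_
      filter_upwards [hu.continuous.continuousAt.eventually_ne h0] with y hy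
      rw [eq_div_iff (pow_ne_zero _ hy), ← hA' y]
  have hS : ∀ a, 0 < normSq (u a) + normSq (v a) + normSq (w a) := by
    intro a
    have p1 := normSq_nonneg (u a)
    have p2 := normSq_nonneg (v a)
    have p3 := normSq_nonneg (w a)
    by_contra hcon
    exact hnz a ⟨normSq_eq_zero.mp (by linarith), normSq_eq_zero.mp (by linarith),
      normSq_eq_zero.mp (by linarith)⟩
  set k : ℝ := min 1 (min (normSq c₁) (normSq c₂)) with hk
  have hkpos : 0 < k := lt_min one_pos (lt_min (normSq_pos.mpr hc₁) (normSq_pos.mpr hc₂))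
  have k1 : k ≤ 1 := min_le_left _ _
  have k2 : k ≤ normSq c₁ := (min_le_right _ _).trans (min_le_left _ _)
  have k3 : k ≤ normSq c₂ := (min_le_right _ _).trans (min_le_right _ _)
  have hzero : ∀ b, h b = 0 := by
    refine fc_vanish m hm h u v w hhd hu hv hw hS (k / 3 ^ (m + 2)) (by positivity) ?_
    intro a
    have e1 : normSq (v a * deriv w a - w a * deriv v a) =
        normSq (h a) * normSq (u a) ^ (m + 2) := by
      have := congrArg normSq (hA' a); simpa [hA] using this
    have e2 : normSq (u a * deriv v a - v a * deriv u a) =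
        normSq (h a) * (normSq c₂ * normSq (w a) ^ (m + 2)) := by
      have := congrArg normSq (hB' a); simpa [hB] using this
    have e3 : normSq (u a * deriv w a - w a * deriv u a) =
        normSq (h a) * (normSq c₁ * normSq (v a) ^ (m + 2)) := by
      have := congrArg normSq (hD' a); simpa [hD] using this
    rw [e1, e2, e3]
    have p0 := normSq_nonneg (h a)
    have p1 := normSq_nonneg (u a)
    have p2 := normSq_nonneg (v a)
    have p3 := normSq_nonneg (w a)
    have hp := fc_pow_sum (m + 2) _ _ _ p1 p2 p3
    calc k / 3 ^ (m + 2) * normSq (h a) * (normSq (u a) + normSq (v a) + normSq (w a)) ^ (m + 2)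
        ≤ k / 3 ^ (m + 2) * normSq (h a) * (3 ^ (m + 2) * (normSq (u a) ^ (m + 2) +
          normSq (v a) ^ (m + 2) + normSq (w a) ^ (m + 2))) := by gcongr
      _ = normSq (h a) * (k * normSq (w a) ^ (m + 2)) + normSq (h a) * (k * normSq (v a) ^ (m + 2))
          + normSq (h a) * (k * normSq (u a) ^ (m + 2)) := by
          field_simp; ring
      _ ≤ normSq (h a) * (normSq c₂ * normSq (w a) ^ (m + 2)) +
          normSq (h a) * (normSq c₁ * normSq (v a) ^ (m + 2))
          + normSq (h a) * (1 * normSq (u a) ^ (m + 2)) := by gcongr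
      _ = _ := by ring
  have wA : ∀ z, v z * deriv w z - w z * deriv v z = 0 := fun z => by
    have := hA' z; rw [hzero z, zero_mul] at this; exact this
  have wB : ∀ z, u z * deriv v z - v z * deriv u z = 0 := fun z => by
    have := hB' z; rw [hzero z, zero_mul] at this; exact this
  have wD : ∀ z, u z * deriv w z - w z * deriv u z = 0 := fun z => by
    have := hD' z; rw [hzero z, zero_mul] at this; exact this
  intro z z' hli
  rw [LinearIndependent.pair_iff] at hli
  have fin : ∀ s t : ℂ, t ≠ 0 → u z * t = s * u z' → v z * t = s * v z' → w z * t = s * w z' →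
      False := by
    intro s t ht h1 h2 h3
    have := hli t (-s) (by
      ext i
      fin_cases i
      · simp; linear_combination h1
      · simp; linear_combination h2
      · simp; linear_combination h3)
    exact ht this.1
  by_cases hu0 : u z' = 0
  · obtain ⟨h2, h3⟩ := hnu z' hu0
    refine fin (w z) (w z') h2 ?_ ?_ (by ring)
    · exact fc_prop u w hu hw wD z' h2 z
    · exact fc_prop v w hv hw wA z' h2 z
  · refine fin (u z) (u z') hu0 (by ring) ?_ ?_
    · exact fc_prop v u hv hu (fun y => by linear_combination -wB y) z' hu0 z
    · exact fc_prop w u hw hu (fun y => by linear_combination -wD y) z' hu0 z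
end
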